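/- The equation 2^r − 1 = 3^s · y^n has no solution in positive integers r, s, y, n with 3 ∤ y, y > 1 and n > 1. -/

import Mathlib

theorem two_pow_dvd_sub_one_of_dvd_pow_sub_one {x : ℤ} {n m : ℕ} (hx : Odd x) (hn : Odd n)
    (h : (2 : ℤ) ^ m ∣ x ^ n - 1) : (2 : ℤ) ^ m ∣ x - 1 := by
  rw [← mul_geom_sum] at h
  have hodd : Odd (∑ i ∈ Finset.range n, x ^ i) := by
    have hdvd : Even (∑ i ∈ Finset.range n, (x ^ i - 1)) :=
      Finset.even_sum _ fun i _ => hx.pow.sub_odd odd_one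
    rw [Finset.sum_sub_distrib] at hdvd
    have hn' : Odd (n : ℤ) := by exact_mod_cast hn
    simpa using hdvd.add_odd hn'
  exact (Int.isCoprime_two_left.mpr hodd).pow_left.dvd_of_dvd_mul_right h

theorem eq_one_of_two_pow_eq_pow_add_one {a m n : ℕ} (hm : 0 < m) (hn : 1 < n)
    (h : 2 ^ m = a ^ n + 1) : a = 1 := by
  have hodd : Odd a := by
    by_contra ha
    have h1 : Even (a ^ n) := (Nat.not_odd_iff_even.mp ha).pow_of_ne_zero (by omega)
    have h2 : Even (2 ^ m) := even_two.pow_of_ne_zero (by omega)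
    rw [h] at h2
    exact Nat.not_even_iff_odd.mpr h1.add_one h2
  by_contra hne
  have ha : 1 < a := by
    have := hodd.pos
    omega
  have hlt : a < a ^ n := lt_self_pow₀ ha hn
  rcases Nat.even_or_odd n with hev | hod
  · obtain ⟨k, rfl⟩ := hev
    have hsq : a ^ (k + k) % 4 = 1 := by
      rw [pow_add]
      have := (hodd.pow (n := k))
      obtain ⟨c, hc⟩ := this
      rw [hc]
      ring_nf
      omega
    have hm2 : 2 ≤ m := by
      by_contra hlt2
      have : m = 1 := by omega
      subst this
      omega
    obtain ⟨j, rfl⟩ := Nat.exists_eq_add_of_le hm2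
    rw [pow_add] at h
    omega
  · have hdvd : (2 : ℤ) ^ m ∣ -(a : ℤ) - 1 := by
      refine two_pow_dvd_sub_one_of_dvd_pow_sub_one (by simpa using hodd) hod ⟨-1, ?_⟩
      have : (2 : ℤ) ^ m = (a : ℤ) ^ n + 1 := by exact_mod_cast h
      rw [this, hod.neg_pow]
      ring
    have hdvd' : 2 ^ m ∣ a + 1 := by
      have := (dvd_neg (α := ℤ)).mpr hdvd
      rw [show -(-(a : ℤ) - 1) = a + 1 by ring] at this
      exact_mod_cast this
    have := Nat.le_of_dvd (by omega) hdvd'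
    omega

theorem four_pow_add_one_ne_pow {b k n : ℕ} (hk : 0 < k) (hn : 1 < n) :
    2 ^ (k + k) + 1 ≠ b ^ n := by
  intro h
  have hpos : 0 < 2 ^ k := by positivity
  rcases Nat.even_or_odd n with ⟨l, rfl⟩ | hod
  · rw [pow_add, pow_add] at h
    have h1 : 2 ^ k < b ^ l := by
      by_contra hle
      have := Nat.mul_le_mul (not_lt.mp hle) (not_lt.mp hle)
      omega
    nlinarith
  · have hodd : Odd b := by
      have h1 : Odd (2 ^ (k + k) + 1) := (even_two.pow_of_ne_zero (by omega)).add_one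
      rw [h] at h1
      exact Nat.Odd.of_mul_left (n := b ^ (n - 1)) (by
        rwa [← pow_succ', Nat.sub_add_cancel hn.le])
    have hb : 1 < b := by
      by_contra hle
      have : b = 1 := by
        have := hodd.pos
        omega
      subst this
      have : 0 < 2 ^ (k + k) := by positivity
      rw [one_pow] at h
      omega
    have hdvd : (2 : ℤ) ^ (k + k) ∣ (b : ℤ) - 1 := by
      refine two_pow_dvd_sub_one_of_dvd_pow_sub_one (by simpa using hodd) hod ⟨1, ?_⟩
      have : (2 : ℤ) ^ (k + k) + 1 = (b : ℤ) ^ n := by exact_mod_cast h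
      linarith
    have hle := Int.le_of_dvd (by omega) hdvd
    have hlt : b < b ^ n := lt_self_pow₀ hb hn
    have : 2 ^ (k + k) + 1 ≤ b := by
      zify
      linarith
    omega

theorem Nat.Coprime.exists_eq_pow_of_mul_eq_prime_pow_mul_pow {p u v s y n : ℕ} (hp : p.Prime)
    (huv : Nat.Coprime u v) (hpu : ¬ p ∣ u) (hn : n ≠ 0) (h : u * v = p ^ s * y ^ n) :
    ∃ a b, u = a ^ n ∧ v = p ^ s * b ^ n ∧ a * b = y := by
  have hcop : Nat.Coprime (p ^ s) u := ((Nat.Prime.coprime_iff_not_dvd hp).mpr hpu).pow_left s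
  obtain ⟨w, rfl⟩ : p ^ s ∣ v := hcop.dvd_of_dvd_mul_left (h ▸ Dvd.intro _ rfl)
  have hw : u * w = y ^ n := by
    have : 0 < p ^ s := pow_pos hp.pos s
    apply Nat.eq_of_mul_eq_mul_left this
    linarith
  have huw : Nat.Coprime u w := huv.coprime_mul_left_right
  obtain ⟨a, ha⟩ := exists_eq_pow_of_mul_eq_pow (Nat.isUnit_iff.mpr huw) hw
  obtain ⟨b, hb⟩ := exists_eq_pow_of_mul_eq_pow (Nat.isUnit_iff.mpr huw.symm)
    ((mul_comm w u).trans hw)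
  refine ⟨a, b, ha, by rw [hb], ?_⟩
  rw [ha, hb, ← mul_pow] at hw
  exact Nat.pow_left_injective hn hw

theorem even_of_three_dvd_two_pow_sub_one {r : ℕ} (h : 3 ∣ 2 ^ r - 1) : Even r := by
  by_contra hr
  obtain ⟨k, rfl⟩ := Nat.not_even_iff_odd.mp hr
  have h4 : 4 ^ k % 3 = 1 := by simp [Nat.pow_mod]
  rw [pow_succ, pow_mul] at h
  norm_num at h
  omega

/-- The equation `2^r - 1 = 3^s · y^n` has no solution in positive integers
`r, s, y, n` with `3 ∤ y`, `y > 1` and `n > 1`. -/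
theorem stmt_3 :
    ¬ ∃ r s y n : ℕ, 0 < r ∧ 0 < s ∧ 0 < y ∧ 0 < n ∧
      ¬ (3 ∣ y) ∧ 1 < y ∧ 1 < n ∧ 2 ^ r = 3 ^ s * y ^ n + 1 := by
  rintro ⟨r, s, y, n, hr, hs, -, -, -, hy, hn, h⟩
  obtain ⟨m, rfl⟩ : Even r := by
    apply even_of_three_dvd_two_pow_sub_one
    rw [h, Nat.add_sub_cancel]
    exact (dvd_pow_self 3 hs.ne').mul_right _
  have hm : 0 < m := by omega
  obtain ⟨u, hu⟩ : ∃ u, 2 ^ m = u + 1 := Nat.exists_eq_add_of_le' Nat.one_le_two_pow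
  have hmul : u * (u + 2) = 3 ^ s * y ^ n := by
    rw [pow_add, hu] at h
    linarith
  have hcop : Nat.Coprime u (u + 2) := by
    have hodd : Odd u := by
      have h2 : Even (2 ^ m) := even_two.pow_of_ne_zero hm.ne'
      rw [hu] at h2
      simpa [Nat.even_add_one] using h2
    simpa using hodd
  by_cases h3 : 3 ∣ u
  · obtain ⟨k, rfl⟩ : Even m := even_of_three_dvd_two_pow_sub_one (by rw [hu]; simpa using h3)
    obtain ⟨b, a, hb, -, -⟩ := hcop.symm.exists_eq_pow_of_mul_eq_prime_pow_mul_pow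
      Nat.prime_three (by omega) (by omega) ((mul_comm _ _).trans hmul)
    exact four_pow_add_one_ne_pow (b := b) (k := k) (by omega) hn (by rw [hu, ← hb])
  · obtain ⟨a, b, ha, hb, hab⟩ := hcop.exists_eq_pow_of_mul_eq_prime_pow_mul_pow
      Nat.prime_three h3 (by omega) hmul
    have ha1 : a = 1 := eq_one_of_two_pow_eq_pow_add_one hm hn (by rw [hu, ha])
    subst ha1
    rw [one_mul] at hab
    subst hab
    rw [one_pow] at ha
    subst ha
    have hlt : b < b ^ n := lt_self_pow₀ hy hn
    have hle : 3 ≤ 3 ^ s := Nat.le_self_pow hs.ne' 3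
    nlinarith
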